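/- Suppose (V, b, Γ, p) is an unfolding of the n×n integer matrix B: a covering of B via p such that for every finite sequence of vertices the iterated orbit mutation of b is skew-symmetric, Γ-equivariant, locally finite, and has no Γ-loops and no Γ-2-cycles. Then for every finite sequence of vertices i₁, …, i_s, the iterated orbit mutation μ̃_{[i_s]}(⋯μ̃_{[i_1]}(b)⋯) together with Γ is a covering of the iterated matrix mutation μ_{p(i_s)}(⋯μ_{p(i_1)}(B)⋯) via p, and the matrix μ_{p(i_s)}(⋯μ_{p(i_1)}(B)⋯) is sign-skew-symmetric. -/

import Mathlib

/-- An `n × n` integer matrix is sign-skew-symmetric. -/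
def SignSkewSymm {n : ℕ} (B : Matrix (Fin n) (Fin n) ℤ) : Prop :=
  ∀ i j, (B i j = 0 ∧ B j i = 0) ∨ B i j * B j i < 0

/-- Matrix mutation in direction `k`. -/
def matMut {n : ℕ} (k : Fin n) (B : Matrix (Fin n) (Fin n) ℤ) : Matrix (Fin n) (Fin n) ℤ :=
  fun i j =>
    if i = k ∨ j = k then - B i j
    else B i j + (|B i k| * B k j + B i k * |B k j|) / 2

/-- `(V, b)` is a covering of `B` via `p`: the sum of `b v w` over each fiber of `p`
equals the corresponding matrix entry. -/
def IsCovering {n : ℕ} {V : Type} (b : V → V → ℤ) (p : V → Fin n)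
    (B : Matrix (Fin n) (Fin n) ℤ) : Prop :=
  ∀ (i : Fin n) (w : V), ∑ᶠ v ∈ p ⁻¹' {i}, b v w = B i (p w)

/-- A quiver encoded by `b : V → V → ℤ` is skew-symmetric. -/
def SkewSymm {V : Type} (b : V → V → ℤ) : Prop := ∀ v w, b v w = - b w v

/-- Local finiteness of the quiver `b`. -/
def LocFin {V : Type} (b : V → V → ℤ) : Prop := ∀ v, {w | b v w ≠ 0}.Finite

/-- `b` is `Γ`-equivariant. -/
def Equivariant {V : Type} (Γ : Type) [Group Γ] [MulAction Γ V] (b : V → V → ℤ) : Prop :=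
  ∀ (g : Γ) (v w : V), b (g • v) (g • w) = b v w

/-- The quiver `b` has no `Γ`-loops. -/
def NoGammaLoops {V : Type} (Γ : Type) [Group Γ] [MulAction Γ V] (b : V → V → ℤ) : Prop :=
  ∀ (v : V) (g : Γ), b v (g • v) = 0

/-- The quiver `b` has no `Γ`-2-cycles. -/
def NoGamma2Cycles {V : Type} (Γ : Type) [Group Γ] [MulAction Γ V] (b : V → V → ℤ) : Prop :=
  ¬ ∃ (v w : V) (g : Γ), w ∉ MulAction.orbit Γ v ∧ 0 < b v w ∧ 0 < b w (g • v)

open Classical in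
/-- Orbit mutation of the quiver `b` at the orbit of the vertex `i`. -/
noncomputable def orbMut {V : Type} (Γ : Type) [Group Γ] [MulAction Γ V]
    (i : V) (b : V → V → ℤ) : V → V → ℤ :=
  fun v w =>
    if v ∈ MulAction.orbit Γ i ∨ w ∈ MulAction.orbit Γ i then - b v w
    else b v w + ∑ᶠ i' ∈ MulAction.orbit Γ i, (|b v i'| * b i' w + b v i' * |b i' w|) / 2

/-- A fiber sum may be computed over any finite set containing the support. -/
theorem cov_sum {n : ℕ} {V : Type} (f : V → ℤ) (p : V → Fin n) (i : Fin n) (F : Finset V)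
    (hF : ∀ v, p v = i → f v ≠ 0 → v ∈ F) :
    ∑ᶠ v ∈ p ⁻¹' {i}, f v = ∑ v ∈ F with p v = i, f v := by
  apply finsum_mem_eq_sum_of_subset
  · rintro v ⟨h1, h2⟩
    have h1' : p v = i := h1
    simp only [Finset.coe_filter, Set.mem_ofPred_eq]
    exact ⟨hF v h1' h2, h1'⟩
  · intro v hv
    simp only [Finset.coe_filter, Set.mem_ofPred_eq] at hv
    exact hv.2

/-- Arrows between two distinct fibers all point in the same direction. -/
theorem sign_coherent {n : ℕ} {V Γ : Type} [Group Γ] [MulAction Γ V]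
    (b : V → V → ℤ) (p : V → Fin n)
    (hfib : ∀ v w : V, p v = p w ↔ w ∈ MulAction.orbit Γ v)
    (hskew : SkewSymm b) (hequiv : Equivariant Γ b) (h2 : NoGamma2Cycles Γ b)
    (i j : Fin n) (hij : i ≠ j) :
    (∀ v w, p v = i → p w = j → 0 ≤ b v w) ∨ (∀ v w, p v = i → p w = j → b v w ≤ 0) := by
  by_contra hcon
  push Not at hcon
  obtain ⟨⟨v', w', hv', hw', hneg⟩, ⟨v, w, hv, hw, hpos⟩⟩ := hcon
  obtain ⟨h, hh⟩ := (hfib w' w).1 (hw'.trans hw.symm)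
  obtain ⟨g, hg⟩ := (hfib v (h • v')).1 (by
    rw [hv, ← hv']; exact (hfib _ _).2 ⟨h, rfl⟩)
  have hh' : h • w' = w := hh
  have hg' : g • v = h • v' := hg
  refine h2 ⟨v, w, g, ?_, hpos, ?_⟩
  · intro hmem
    have := (hfib v w).2 hmem
    exact hij (by rw [← hv, ← hw, this])
  · rw [hg', ← hh', hequiv, hskew]
    omega

theorem abs_sum_coherent {V : Type} (F : Finset V) (f : V → ℤ)
    (h : (∀ v ∈ F, 0 ≤ f v) ∨ (∀ v ∈ F, f v ≤ 0)) : ∑ v ∈ F, |f v| = |∑ v ∈ F, f v| := by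
  rcases h with h | h
  · rw [abs_of_nonneg (Finset.sum_nonneg h)]
    exact Finset.sum_congr rfl fun v hv => abs_of_nonneg (h v hv)
  · rw [abs_of_nonpos (Finset.sum_nonpos h), ← Finset.sum_neg_distrib]
    exact Finset.sum_congr rfl fun v hv => abs_of_nonpos (h v hv)

theorem locfin_left {V : Type} (b : V → V → ℤ) (hskew : SkewSymm b) (hfin : LocFin b) (w : V) :
    {v | b v w ≠ 0}.Finite := by
  refine (hfin w).subset fun v hv => ?_
  have := hskew v w
  simp only [Set.mem_ofPred_eq] at hv ⊢
  omega

theorem two_mul_num (x y : ℤ) : 2 * ((|x| * y + x * |y|) / 2) = |x| * y + x * |y| := by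
  apply Int.mul_ediv_cancel'
  rcases abs_cases x with ⟨hx, -⟩ | ⟨hx, -⟩ <;> rcases abs_cases y with ⟨hy, -⟩ | ⟨hy, -⟩ <;>
    rw [hx, hy]
  · exact ⟨x * y, by ring⟩
  · exact ⟨0, by ring⟩
  · exact ⟨0, by ring⟩
  · exact ⟨-(x * y), by ring⟩

theorem signSkew_of_covering {n : ℕ} {V Γ : Type} [Group Γ] [MulAction Γ V]
    (b : V → V → ℤ) (B : Matrix (Fin n) (Fin n) ℤ) (p : V → Fin n)
    (hsurj : Function.Surjective p)
    (hfib : ∀ v w : V, p v = p w ↔ w ∈ MulAction.orbit Γ v)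
    (hcov : IsCovering b p B)
    (hskew : SkewSymm b) (hequiv : Equivariant Γ b) (hfin : LocFin b)
    (hl : NoGammaLoops Γ b) (h2 : NoGamma2Cycles Γ b) : SignSkewSymm B := by
  have hsum : ∀ i w, ∑ v ∈ (locfin_left b hskew hfin w).toFinset with p v = i, b v w
      = B i (p w) := by
    intro i w
    rw [← hcov i w]
    refine (cov_sum (fun v => b v w) p i _ ?_).symm
    intro v _ hv
    simpa using hv
  have hdiag : ∀ i, B i i = 0 := by
    intro i
    obtain ⟨w, rfl⟩ := hsurj i
    rw [← hsum]
    apply Finset.sum_eq_zero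
    intro v hv
    obtain ⟨g, hg⟩ := (hfib w v).1 (Finset.mem_filter.1 hv).2.symm
    have hg' : g • w = v := hg
    rw [hskew, ← hg', hl, neg_zero]
  have hpos : ∀ i j, i ≠ j → 0 < B i j → B j i < 0 := by
    intro i j hij h
    obtain ⟨w, rfl⟩ := hsurj j
    rw [← hsum] at h
    obtain ⟨v, hv, hvpos⟩ := Finset.exists_lt_of_sum_lt (s := _) (f := fun _ => (0 : ℤ))
      (by simpa using h)
    obtain ⟨-, rfl⟩ := Finset.mem_filter.1 hv
    have hneg : b w v < 0 := by rw [hskew]; omega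
    rw [← hsum]
    have hle : ∀ w' v', p w' = p w → p v' = p v → b w' v' ≤ 0 := by
      rcases sign_coherent b p hfib hskew hequiv h2 (p w) (p v) hij.symm with h | h
      · have := h w v rfl rfl; omega
      · exact h
    exact Finset.sum_neg' (fun w' hw' => hle _ _ (Finset.mem_filter.1 hw').2 rfl)
      ⟨w, by simp [hneg.ne], hneg⟩
  have hng : ∀ i j, i ≠ j → B i j < 0 → 0 < B j i := by
    intro i j hij h
    obtain ⟨w, rfl⟩ := hsurj j
    rw [← hsum] at h
    obtain ⟨v, hv, hvneg⟩ := Finset.exists_lt_of_sum_lt (s := _) (g := fun _ => (0 : ℤ))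
      (by simpa using h)
    obtain ⟨-, rfl⟩ := Finset.mem_filter.1 hv
    have hps : 0 < b w v := by rw [hskew]; omega
    rw [← hsum]
    have hle : ∀ w' v', p w' = p w → p v' = p v → 0 ≤ b w' v' := by
      rcases sign_coherent b p hfib hskew hequiv h2 (p w) (p v) hij.symm with h | h
      · exact h
      · have := h w v rfl rfl; omega
    exact Finset.sum_pos' (fun w' hw' => hle _ _ (Finset.mem_filter.1 hw').2 rfl)
      ⟨w, by simp [hps.ne'], hps⟩
  intro i j
  rcases eq_or_ne i j with rfl | hij
  · exact Or.inl ⟨hdiag i, hdiag i⟩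
  rcases lt_trichotomy (B i j) 0 with h | h | h
  · exact Or.inr (mul_neg_of_neg_of_pos h (hng i j hij h))
  · left
    refine ⟨h, ?_⟩
    rcases lt_trichotomy (B j i) 0 with h' | h' | h'
    · have := hng j i hij.symm h'; omega
    · exact h'
    · have := hpos j i hij.symm h'; omega
  · exact Or.inr (mul_neg_of_pos_of_neg h (hpos i j hij h))

theorem covering_step {n : ℕ} {V Γ : Type} [Group Γ] [MulAction Γ V]
    (b : V → V → ℤ) (B : Matrix (Fin n) (Fin n) ℤ) (p : V → Fin n)
    (hfib : ∀ v w : V, p v = p w ↔ w ∈ MulAction.orbit Γ v)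
    (hcov : IsCovering b p B)
    (hskew : SkewSymm b) (hequiv : Equivariant Γ b) (hfin : LocFin b)
    (h2 : NoGamma2Cycles Γ b) (k : V) :
    IsCovering (orbMut Γ k b) p (matMut (p k) B) := by
  classical
  intro j w
  have horb : ∀ v, v ∈ MulAction.orbit Γ k ↔ p v = p k := fun v => by
    rw [← hfib, eq_comm]
  have horbset : MulAction.orbit Γ k = p ⁻¹' {p k} := by
    ext v; simpa using horb v
  have hsum : ∀ i w (F : Finset V), (∀ v, b v w ≠ 0 → v ∈ F) →
      ∑ v ∈ F with p v = i, b v w = B i (p w) := by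
    intro i w F hF
    rw [← hcov i w]
    exact (cov_sum (fun v => b v w) p i _ fun v _ hv => hF v hv).symm
  have hasum : ∀ i w (F : Finset V), i ≠ p w → (∀ v, b v w ≠ 0 → v ∈ F) →
      ∑ v ∈ F with p v = i, |b v w| = |B i (p w)| := by
    intro i w F hi hF
    rw [← hsum i w F hF]
    apply abs_sum_coherent
    rcases sign_coherent b p hfib hskew hequiv h2 i (p w) hi with h | h
    · exact Or.inl fun v hv => h v w (Finset.mem_filter.1 hv).2 rfl
    · exact Or.inr fun v hv => h v w (Finset.mem_filter.1 hv).2 rfl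
  by_cases hc : j = p k ∨ p w = p k
  · simp only [matMut, if_pos hc]
    have hval : ∀ v, p v = j → orbMut Γ k b v w = - b v w := by
      intro v hv
      simp only [orbMut]
      rw [if_pos]
      rw [horb, horb, hv]
      exact hc
    have hT : ∀ v, b v w ≠ 0 → v ∈ (locfin_left b hskew hfin w).toFinset :=
      fun v hv => by simpa using hv
    rw [cov_sum (fun v => orbMut Γ k b v w) p j (locfin_left b hskew hfin w).toFinset
      (fun v hv h => hT v (by rw [hval v hv] at h; omega)), ← hsum j w _ hT,
      ← Finset.sum_neg_distrib]
    exact Finset.sum_congr rfl fun v hv => hval v (Finset.mem_filter.1 hv).2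
  · simp only [matMut, if_neg hc]
    push Not at hc
    obtain ⟨hj, hw⟩ := hc
    let T : Finset V := (locfin_left b hskew hfin w).toFinset
    have hT : ∀ v, b v w ≠ 0 → v ∈ T := fun v hv => by simpa [T] using hv
    let F : Finset V := T ∪ T.biUnion fun t => (locfin_left b hskew hfin t).toFinset
    have hF : ∀ v, b v w ≠ 0 → v ∈ F := fun v hv => Finset.mem_union_left _ (hT v hv)
    have hF' : ∀ t ∈ T, ∀ v, b v t ≠ 0 → v ∈ F := fun t ht v hv =>
      Finset.mem_union_right _ (Finset.mem_biUnion.2 ⟨t, ht, by simpa using hv⟩)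
    have hinner : ∀ v, p v = j → orbMut Γ k b v w =
        b v w + ∑ t ∈ T with p t = p k, (|b v t| * b t w + b v t * |b t w|) / 2 := by
      intro v hv
      simp only [orbMut]
      rw [if_neg (by rw [horb, horb, hv]; tauto), horbset]
      congr 1
      apply cov_sum
      intro t _ ht
      apply hT
      intro h0
      simp [h0] at ht
    have houter : ∀ v, p v = j → orbMut Γ k b v w ≠ 0 → v ∈ F := by
      intro v hv hne
      by_contra hvF
      apply hne
      rw [hinner v hv]
      have h1 : b v w = 0 := by
        by_contra h; exact hvF (hF v h)
      rw [h1, zero_add]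
      apply Finset.sum_eq_zero
      intro t ht
      have h3 : b v t = 0 := by
        by_contra h; exact hvF (hF' t (Finset.mem_filter.1 ht).1 v h)
      simp [h3]
    rw [cov_sum (fun v => orbMut Γ k b v w) p j F houter]
    have key : ∑ v ∈ F with p v = j, orbMut Γ k b v w = B j (p w) +
        ∑ v ∈ F with p v = j, ∑ t ∈ T with p t = p k,
          (|b v t| * b t w + b v t * |b t w|) / 2 := by
      rw [← hsum j w F hF, ← Finset.sum_add_distrib]
      exact Finset.sum_congr rfl fun v hv => hinner v (Finset.mem_filter.1 hv).2
    rw [key]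
    congr 1
    have h2x : 2 * ∑ v ∈ F with p v = j, ∑ t ∈ T with p t = p k,
          (|b v t| * b t w + b v t * |b t w|) / 2
        = |B j (p k)| * B (p k) (p w) + B j (p k) * |B (p k) (p w)| := by
      simp only [Finset.mul_sum, two_mul_num]
      rw [Finset.sum_comm, ← hasum (p k) w T (Ne.symm hw) hT, ← hsum (p k) w T hT,
        Finset.mul_sum, Finset.mul_sum, ← Finset.sum_add_distrib]
      refine Finset.sum_congr rfl fun t ht => ?_
      obtain ⟨htT, htk⟩ := Finset.mem_filter.1 ht
      rw [Finset.sum_add_distrib, ← Finset.sum_mul, ← Finset.sum_mul,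
        hsum j t F (hF' t htT), hasum j t F (by rw [htk]; exact hj) (hF' t htT), htk]
    omega

/-- If `(V, b, Γ, p)` is an unfolding of the matrix `B` (a covering of `B` via `p` such that
every iterated orbit mutation of `b` is skew-symmetric, `Γ`-equivariant, locally finite, and
has no `Γ`-loops and no `Γ`-2-cycles), then for every finite sequence of vertices the
iterated orbit mutation of `b` is a covering via `p` of the correspondingly iterated matrix
mutation of `B`, and the latter matrix is sign-skew-symmetric. -/
theorem unfolding_iterated_mutation_covering {n : ℕ} {V Γ : Type} [Group Γ] [MulAction Γ V]
    (b : V → V → ℤ) (B : Matrix (Fin n) (Fin n) ℤ) (p : V → Fin n)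
    (hsurj : Function.Surjective p)
    (hfib : ∀ v w : V, p v = p w ↔ w ∈ MulAction.orbit Γ v)
    (hcov : IsCovering b p B)
    (hmut_skew : ∀ is : List V, SkewSymm (is.foldl (fun c i => orbMut Γ i c) b))
    (hmut_equiv : ∀ is : List V, Equivariant Γ (is.foldl (fun c i => orbMut Γ i c) b))
    (hmut_locfin : ∀ is : List V, LocFin (is.foldl (fun c i => orbMut Γ i c) b))
    (hmut_noLoops : ∀ is : List V, NoGammaLoops Γ (is.foldl (fun c i => orbMut Γ i c) b))
    (hmut_no2Cycles : ∀ is : List V, NoGamma2Cycles Γ (is.foldl (fun c i => orbMut Γ i c) b))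
    (is : List V) :
    IsCovering (is.foldl (fun c i => orbMut Γ i c) b) p
        ((is.map p).foldl (fun M k => matMut k M) B) ∧
      SignSkewSymm ((is.map p).foldl (fun M k => matMut k M) B) := by
  have hc : ∀ is : List V, IsCovering (is.foldl (fun c i => orbMut Γ i c) b) p
        ((is.map p).foldl (fun M k => matMut k M) B) := by
    intro is
    induction is using List.reverseRecOn with
    | nil => exact hcov
    | append_singleton l k ih =>
      simp only [List.map_append, List.foldl_append, List.map_cons, List.map_nil,
        List.foldl_cons, List.foldl_nil]
      exact covering_step _ _ p hfib ih (hmut_skew l) (hmut_equiv l) (hmut_locfin l)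
        (hmut_no2Cycles l) k
  exact ⟨hc is, signSkew_of_covering _ _ p hsurj hfib (hc is) (hmut_skew is) (hmut_equiv is)
    (hmut_locfin is) (hmut_noLoops is) (hmut_no2Cycles is)⟩
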